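/- arXiv:1807.07507 — 2 statements merged into one kernel-verified Lean document; each statement's English description precedes it below -/
import Mathlib

section
/- Let P_ℓ ⊆ ℝ^K for ℓ = 1,…,L each be compact, convex, with nonempty interior, let K_ℓ ⊆ ℝ^{K+1} be the conic hull of {(x,1) : x ∈ P_ℓ}, and let P = {Σ_{ℓ=1}^L x_ℓ : x_ℓ ∈ P_ℓ for each ℓ} be the Minkowski sum. Define the cone K = {(x₁,…,x_L,τ) ∈ ℝ^{LK+1} : (x_ℓ, τ) ∈ K_ℓ for every ℓ}, and for a symmetric positive definite A ∈ ℝ^{K×K} let Ã = [A; A; … ; A] ∈ ℝ^{LK×K} be the vertical stack of L copies of A. Then for b ∈ ℝ^K, P ⊆ E(A,b) if and only if there exist a symmetric F ∈ ℝ^{LK×LK}, g ∈ ℝ^{LK}, and h ∈ ℝ such that vᵀ·[[F, g],[gᵀ, h−1]]·v ≤ 0 for all v ∈ K, and the (LK+1+K)×(LK+1+K) block matrix [[F, g, Ã],[gᵀ, h, bᵀ],[Ãᵀ, b, I_K]] is positive semidefinite. -/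
open Matrix

noncomputable section

/-- The ellipsoid `E(A,b) = {x : ‖Ax + b‖² ≤ 1}` (Euclidean norm). -/
def ellipsoid {K : ℕ} (A : Matrix (Fin K) (Fin K) ℝ) (b : Fin K → ℝ) :
    Set (Fin K → ℝ) :=
  {x | (A *ᵥ x + b) ⬝ᵥ (A *ᵥ x + b) ≤ 1}

/-- The conic hull of `{(x, 1) : x ∈ P}` inside `ℝ^{K+1}`, where the extra (last)
coordinate is indexed by `Unit`. -/
def liftCone {ι : Type*} (P : Set (ι → ℝ)) : Set ((ι ⊕ Unit) → ℝ) :=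
  {v | ∃ (n : ℕ) (lam : Fin n → ℝ) (xs : Fin n → (ι → ℝ)),
    (∀ i, 0 ≤ lam i) ∧ (∀ i, xs i ∈ P) ∧
    v = ∑ i, lam i • (Sum.elim (xs i) (fun _ => (1 : ℝ)))}

/-- The block matrix `[[F, g],[gᵀ, c]]`. -/
def blk2 {ι : Type*} (F : Matrix ι ι ℝ) (g : ι → ℝ) (c : ℝ) :
    Matrix (ι ⊕ Unit) (ι ⊕ Unit) ℝ :=
  Matrix.fromBlocks F (Matrix.of fun i _ => g i) (Matrix.of fun _ j => g j)
    (Matrix.of fun _ _ => c)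

/-- The block matrix `[[F, g, Abᵀ],[gᵀ, h, bᵀ],[Ab, b, I]]` for a rectangular `Ab`. -/
def blk3g {ι κ : Type*} [DecidableEq κ] (F : Matrix ι ι ℝ) (g : ι → ℝ) (h : ℝ)
    (Ab : Matrix κ ι ℝ) (b : κ → ℝ) :
    Matrix ((ι ⊕ Unit) ⊕ κ) ((ι ⊕ Unit) ⊕ κ) ℝ :=
  Matrix.fromBlocks (blk2 F g h)
    (Matrix.of (Sum.elim (fun i j => Ab j i) (fun _ j => b j)))
    (Matrix.of fun i => Sum.elim (fun j => Ab i j) (fun _ => b i))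
    1

/-- `Ã = [A; A; … ; A] ∈ ℝ^{LK×K}`, the vertical stack of `L` copies of `A`
(rows indexed by `Fin L × Fin K`). -/
def Atil {K L : ℕ} (A : Matrix (Fin K) (Fin K) ℝ) :
    Matrix (Fin L × Fin K) (Fin K) ℝ :=
  Matrix.of fun p j => A p.2 j

/-- The rectangular block `[Ab, b]`. -/
def augment {ι κ : Type*} (Ab : Matrix κ ι ℝ) (b : κ → ℝ) : Matrix κ (ι ⊕ Unit) ℝ :=
  Matrix.of fun i => Sum.elim (fun j => Ab i j) (fun _ => b i)

lemma augment_mulVec {ι κ : Type*} [Fintype ι] (Ab : Matrix κ ι ℝ) (b : κ → ℝ)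
    (v : ι ⊕ Unit → ℝ) :
    augment Ab b *ᵥ v = Ab *ᵥ (fun i => v (Sum.inl i)) + v (Sum.inr ()) • b := by
  ext i
  simp [augment, mulVec, dotProduct, mul_comm]

/-- Schur complement of the identity block in `blk3g`. -/
lemma posSemidef_blk3g_iff {ι κ : Type*} [Fintype ι] [Fintype κ] [DecidableEq κ]
    (F : Matrix ι ι ℝ) (g : ι → ℝ) (h : ℝ) (Ab : Matrix κ ι ℝ) (b : κ → ℝ) :
    (blk3g F g h Ab b).PosSemidef ↔
      (blk2 F g h - (augment Ab b)ᵀ * augment Ab b).PosSemidef := by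
  have hblk : blk3g F g h Ab b =
      fromBlocks (blk2 F g h) (augment Ab b)ᵀ ((augment Ab b)ᵀ)ᴴ 1 := by
    ext (i | i) (j | j)
    · rfl
    · rcases i with i | i <;> rfl
    · rfl
    · rfl
  let : Invertible (1 : Matrix κ κ ℝ) := invertibleOne
  rw [hblk, PosDef.fromBlocks₂₂ _ _ PosDef.one]
  simp

lemma dotProduct_blk2_sub_one {ι : Type*} [Fintype ι] (F : Matrix ι ι ℝ) (g : ι → ℝ) (h : ℝ)
    (v : ι ⊕ Unit → ℝ) :
    v ⬝ᵥ (blk2 F g (h - 1) *ᵥ v) = v ⬝ᵥ (blk2 F g h *ᵥ v) - v (Sum.inr ()) ^ 2 := by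
  simp [blk2, mulVec, dotProduct]
  ring

lemma dotProduct_transpose_mul_self_mulVec {m n : Type*} [Fintype m] [Fintype n]
    (N : Matrix m n ℝ) (v : n → ℝ) :
    v ⬝ᵥ ((Nᵀ * N) *ᵥ v) = (N *ᵥ v) ⬝ᵥ (N *ᵥ v) := by
  rw [← mulVec_mulVec, dotProduct_mulVec, vecMul_transpose]

lemma blk2_gram {ι κ : Type*} [Fintype κ] (Ab : Matrix κ ι ℝ) (b : κ → ℝ) :
    blk2 (Abᵀ * Ab) (Abᵀ *ᵥ b) (b ⬝ᵥ b) = (augment Ab b)ᵀ * augment Ab b := by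
  ext (i | i) (j | j) <;>
    simp [blk2, augment, mul_apply, mulVec, dotProduct, mul_comm]

/-- A point of the conic hull of `P × {1}` is a multiple of a point of `P × {1}`. -/
lemma exists_eq_smul_of_mem_liftCone {ι : Type*} {P : Set (ι → ℝ)} (hP : Convex ℝ P)
    (hne : P.Nonempty) {w : ι ⊕ Unit → ℝ} (hw : w ∈ liftCone P) :
    ∃ x ∈ P, ∀ i, w (Sum.inl i) = w (Sum.inr ()) * x i := by
  obtain ⟨n, lam, xs, hlam, hxs, rfl⟩ := hw
  have hsum : ∑ i, lam i = 0 ∨ 0 < ∑ i, lam i :=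
    (Finset.sum_nonneg fun i _ => hlam i).eq_or_lt.imp_left Eq.symm
  rcases hsum with hsum | hsum
  · obtain ⟨x, hx⟩ := hne
    have hzero := (Finset.sum_eq_zero_iff_of_nonneg fun i _ => hlam i).1 hsum
    exact ⟨x, hx, fun i => by simp [fun j => hzero j (Finset.mem_univ j)]⟩
  · refine ⟨_, hP.centerMass_mem (fun i _ => hlam i) hsum (fun i _ => hxs i), fun i => ?_⟩
    simp [Finset.centerMass, mul_inv_cancel_left₀ hsum.ne']

lemma mem_liftCone {ι : Type*} {P : Set (ι → ℝ)} {x : ι → ℝ} (hx : x ∈ P) :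
    Sum.elim x (fun _ => (1 : ℝ)) ∈ liftCone P :=
  ⟨1, fun _ => 1, fun _ => x, fun _ => zero_le_one, fun _ => hx, by simp⟩

lemma transpose_Atil_mulVec {K L : ℕ} {A : Matrix (Fin K) (Fin K) ℝ} (hA : A.IsSymm)
    (x : Fin L → Fin K → ℝ) :
    (Atil A)ᵀ *ᵥ (fun p : Fin L × Fin K => x p.1 p.2) = A *ᵥ ∑ ℓ, x ℓ := by
  ext i
  simp only [Atil, mulVec, dotProduct, transpose_apply, of_apply, Fintype.sum_prod_type,
    Finset.sum_apply, Finset.mul_sum, hA.apply]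
  exact Finset.sum_comm

/-- Minkowski sum of sets: `P = P_1 + ⋯ + P_L ⊆ E(A,b)` iff the generalized copositive
containment certificate w.r.t. the cone
`K = {(x₁,…,x_L,τ) : (x_ℓ,τ) ∈ K_ℓ ∀ℓ}` exists, with `Ã` the vertical stack of `A`. -/
theorem stmt_6 {K L : ℕ} (P : Fin L → Set (Fin K → ℝ))
    (hPc : ∀ ℓ, IsCompact (P ℓ)) (hPconv : ∀ ℓ, Convex ℝ (P ℓ))
    (hPint : ∀ ℓ, (interior (P ℓ)).Nonempty)
    (A : Matrix (Fin K) (Fin K) ℝ) (hA : A.PosDef) (b : Fin K → ℝ) :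
    {z : Fin K → ℝ | ∃ x : Fin L → (Fin K → ℝ), (∀ ℓ, x ℓ ∈ P ℓ) ∧ z = ∑ ℓ, x ℓ}
        ⊆ ellipsoid A b ↔
      ∃ (F : Matrix (Fin L × Fin K) (Fin L × Fin K) ℝ)
        (g : (Fin L × Fin K) → ℝ) (h : ℝ), F.IsSymm ∧
        (∀ v : ((Fin L × Fin K) ⊕ Unit) → ℝ,
          (∀ ℓ, (Sum.elim (fun k => v (Sum.inl (ℓ, k))) (fun u => v (Sum.inr u)))
            ∈ liftCone (P ℓ)) →
          v ⬝ᵥ ((blk2 F g (h - 1)) *ᵥ v) ≤ 0) ∧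
        (blk3g F g h (Atil A)ᵀ b).PosSemidef := by
  have hsymm : A.IsSymm := by simpa [IsHermitian, IsSymm] using hA.isHermitian
  constructor
  · intro hsub
    refine ⟨(Atil A)ᵀᵀ * (Atil A)ᵀ, (Atil A)ᵀᵀ *ᵥ b, b ⬝ᵥ b, by
      simp [IsSymm], ?_, ?_⟩
    · intro v hv
      choose x hx hvx using fun ℓ => exists_eq_smul_of_mem_liftCone (hPconv ℓ)
        ((hPint ℓ).mono interior_subset) (hv ℓ)
      simp only [Sum.elim_inl, Sum.elim_inr] at hvx
      have hmem : (A *ᵥ (∑ ℓ, x ℓ) + b) ⬝ᵥ (A *ᵥ (∑ ℓ, x ℓ) + b) ≤ 1 := hsub ⟨x, hx, rfl⟩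
      have hv' : (fun p => v (Sum.inl p)) = v (Sum.inr ()) • fun p => x p.1 p.2 :=
        funext fun p => hvx p.1 p.2
      rw [dotProduct_blk2_sub_one, blk2_gram, dotProduct_transpose_mul_self_mulVec,
        augment_mulVec, hv', mulVec_smul, transpose_Atil_mulVec hsymm, ← smul_add,
        smul_dotProduct, dotProduct_smul]
      simp only [smul_eq_mul]
      nlinarith [mul_le_mul_of_nonneg_left hmem (sq_nonneg (v (Sum.inr ())))]
    · rw [posSemidef_blk3g_iff, blk2_gram, sub_self]
      exact PosSemidef.zero
  · rintro ⟨F, g, h, -, hcop, hpsd⟩ _ ⟨x, hx, rfl⟩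
    set v : (Fin L × Fin K) ⊕ Unit → ℝ := Sum.elim (fun p => x p.1 p.2) (fun _ => 1) with hv
    have hle := hcop v fun ℓ => mem_liftCone (hx ℓ)
    have hnonneg := ((posSemidef_blk3g_iff _ _ _ _ _).1 hpsd).dotProduct_mulVec_nonneg v
    rw [star_trivial, sub_mulVec, dotProduct_sub, dotProduct_transpose_mul_self_mulVec,
      augment_mulVec] at hnonneg
    rw [dotProduct_blk2_sub_one] at hle
    simp only [hv, Sum.elim_inl, Sum.elim_inr, transpose_Atil_mulVec hsymm, one_smul]
      at hnonneg hle
    change (A *ᵥ (∑ ℓ, x ℓ) + b) ⬝ᵥ (A *ᵥ (∑ ℓ, x ℓ) + b) ≤ 1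
    linarith
end
end

section
/- Let Ξ = {ξ ∈ ℝ^K : S₀ξ ≤ t₀, ‖A₀ξ + b₀‖² ≤ 1} with S₀ ∈ ℝ^{L×K}, t₀ ∈ ℝ^L, A₀ ∈ ℝ^{K×K} symmetric, b₀ ∈ ℝ^K, and let W, Y ∈ ℝ^{N×K}, w, y ∈ ℝ^N, T ∈ ℝ^K, and h ∈ ℝ. Suppose there exist an entrywise nonnegative ρ ∈ ℝ^L and λ ≥ 0 such that the (K+1)×(K+1) matrix [[(1/2)(WᵀY + YᵀW), (1/2)(Wᵀy + Yᵀw)],[(1/2)(Wᵀy + Yᵀw)ᵀ, wᵀy]] − [[0, (1/2)T],[(1/2)Tᵀ, h]] + [[0, (1/2)S₀ᵀρ],[(1/2)(S₀ᵀρ)ᵀ, −t₀ᵀρ]] + λ·[[A₀², A₀b₀],[(A₀b₀)ᵀ, b₀ᵀb₀ − 1]] is positive semidefinite. Then Tᵀξ + h ≤ (Wξ + w)ᵀ(Yξ + y) for all ξ ∈ Ξ. -/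
open Matrix

noncomputable section

/-- The quadratic form of `[[F, g],[gᵀ, c]]` at `(ξ, 1)`. -/
theorem dotProduct_blk2_mulVec {ι : Type*} [Fintype ι] (F : Matrix ι ι ℝ) (g : ι → ℝ) (c : ℝ)
    (ξ : ι → ℝ) :
    Sum.elim ξ (fun _ : Unit => (1 : ℝ)) ⬝ᵥ (blk2 F g c *ᵥ Sum.elim ξ fun _ => 1) =
      ξ ⬝ᵥ (F *ᵥ ξ) + 2 * (g ⬝ᵥ ξ) + c := by
  have hg : (of fun (i : ι) (_ : Unit) => g i) *ᵥ (fun _ => (1 : ℝ)) = g := by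
    ext i
    simp [mulVec, dotProduct]
  have hr : (of fun (_ : Unit) (j : ι) => g j) *ᵥ ξ = fun _ => g ⬝ᵥ ξ := rfl
  have hc : (of fun (_ _ : Unit) => c) *ᵥ (fun _ => (1 : ℝ)) = fun _ => c := by
    ext i
    simp [mulVec, dotProduct]
  rw [blk2, fromBlocks_mulVec, sumElim_dotProduct_sumElim]
  simp only [Sum.elim_comp_inl, Sum.elim_comp_inr, hg, hr, hc, dotProduct_add]
  rw [dotProduct_comm ξ g]
  simp [dotProduct]
  ring

/-- Moving a matrix across the dot product. -/
theorem dotProduct_transpose_mulVec_eq {m n : Type*} [Fintype m] [Fintype n]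
    (A : Matrix m n ℝ) (u : m → ℝ) (v : n → ℝ) :
    v ⬝ᵥ (Aᵀ *ᵥ u) = (A *ᵥ v) ⬝ᵥ u := by
  rw [dotProduct_mulVec, vecMul_transpose]

/-- 𝒮-procedure certificate that the decision-rule constraint
`Tᵀξ + h ≤ (Wξ + w)ᵀ(Yξ + y)` holds for all `ξ` in the set
`Ξ = {ξ : S₀ξ ≤ t₀, ‖A₀ξ + b₀‖² ≤ 1}`. -/
theorem stmt_14 {K L N : ℕ}
    (S₀ : Matrix (Fin L) (Fin K) ℝ) (t₀ : Fin L → ℝ)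
    (A₀ : Matrix (Fin K) (Fin K) ℝ) (hA₀ : A₀.IsSymm) (b₀ : Fin K → ℝ)
    (W Y : Matrix (Fin N) (Fin K) ℝ) (w y : Fin N → ℝ)
    (T : Fin K → ℝ) (h : ℝ)
    (ρ : Fin L → ℝ) (hρ : ∀ j, 0 ≤ ρ j) (lam : ℝ) (hlam : 0 ≤ lam)
    (hpsd : (blk2 ((1/2 : ℝ) • (Wᵀ * Y + Yᵀ * W)) ((1/2 : ℝ) • (Wᵀ *ᵥ y + Yᵀ *ᵥ w)) (w ⬝ᵥ y)
        - blk2 0 ((1/2 : ℝ) • T) h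
        + blk2 0 ((1/2 : ℝ) • (S₀ᵀ *ᵥ ρ)) (-(t₀ ⬝ᵥ ρ))
        + lam • blk2 (A₀ * A₀) (A₀ *ᵥ b₀) (b₀ ⬝ᵥ b₀ - 1)).PosSemidef) :
    ∀ ξ : Fin K → ℝ, S₀ *ᵥ ξ ≤ t₀ → (A₀ *ᵥ ξ + b₀) ⬝ᵥ (A₀ *ᵥ ξ + b₀) ≤ 1 →
      T ⬝ᵥ ξ + h ≤ (W *ᵥ ξ + w) ⬝ᵥ (Y *ᵥ ξ + y) := by
  intro ξ hS hA
  have hq := hpsd.dotProduct_mulVec_nonneg (Sum.elim ξ fun _ : Unit => (1 : ℝ))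
  simp only [star_trivial, add_mulVec, sub_mulVec, smul_mulVec, dotProduct_add, dotProduct_sub,
    dotProduct_smul, dotProduct_blk2_mulVec, smul_eq_mul, smul_dotProduct, zero_mulVec,
    dotProduct_zero, ← mulVec_mulVec, dotProduct_transpose_mulVec_eq, add_dotProduct] at hq
  have hAt : ∀ u : Fin K → ℝ, ξ ⬝ᵥ (A₀ *ᵥ u) = (A₀ *ᵥ ξ) ⬝ᵥ u := fun u => by
    rw [← dotProduct_transpose_mulVec_eq, hA₀.eq]
  have hρS : (S₀ *ᵥ ξ) ⬝ᵥ ρ ≤ t₀ ⬝ᵥ ρ := dotProduct_le_dotProduct_of_nonneg_right hS hρ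
  have hlamA := mul_le_mul_of_nonneg_left hA hlam
  simp only [dotProduct_comm _ ξ, dotProduct_transpose_mulVec_eq, hAt] at hq
  simp only [dotProduct_add, add_dotProduct, dotProduct_comm b₀ (A₀ *ᵥ ξ)] at hlamA
  simp only [dotProduct_add, add_dotProduct]
  rw [dotProduct_comm (Y *ᵥ ξ) (W *ᵥ ξ), dotProduct_comm (Y *ᵥ ξ) w] at hq
  rw [dotProduct_comm T ξ]
  linarith
end
end
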